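/- Let (s, ⟨·,·⟩) be a metric solvable Lie algebra. Then tr(R·E) = (1/4)·⟨π(E)[·,·], [·,·]⟩ for every E ∈ End(s), where [·,·] denotes the Lie bracket of s regarded as a bilinear map s × s → s. In particular, taking E = I, the scalar curvature satisfies tr(R) = -(1/4)·‖[·,·]‖². -/

import Mathlib

noncomputable section

open scoped RealInnerProductSpace

/-! ### Lie-algebraic notions for a bracket given as a bundled bilinear map -/

section Alg

variable {E : Type*} [AddCommGroup E] [Module ℝ E]

/-- `μ` is a Lie bracket: alternating and satisfying the (Leibniz form of the) Jacobi identity. -/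
def IsLieBracket (μ : E →ₗ[ℝ] E →ₗ[ℝ] E) : Prop :=
  (∀ X, μ X X = 0) ∧ ∀ X Y Z, μ X (μ Y Z) = μ (μ X Y) Z + μ Y (μ X Z)

/-- `D` is a derivation of the algebra `(E, μ)`. -/
def IsDeriv (μ : E →ₗ[ℝ] E →ₗ[ℝ] E) (D : E →ₗ[ℝ] E) : Prop :=
  ∀ X Y, D (μ X Y) = μ (D X) Y + μ X (D Y)

/-- The subspace spanned by brackets of elements of `p` and `q`. -/
def bracketSpan (μ : E →ₗ[ℝ] E →ₗ[ℝ] E) (p q : Submodule ℝ E) : Submodule ℝ E :=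
  Submodule.span ℝ {z | ∃ x ∈ p, ∃ y ∈ q, μ x y = z}

/-- Derived series of `(E, μ)`. -/
def derSeries (μ : E →ₗ[ℝ] E →ₗ[ℝ] E) : ℕ → Submodule ℝ E
  | 0 => ⊤
  | k + 1 => bracketSpan μ (derSeries μ k) (derSeries μ k)

/-- `(E, μ)` is a solvable Lie algebra. -/
def IsSolvableB (μ : E →ₗ[ℝ] E →ₗ[ℝ] E) : Prop := ∃ k, derSeries μ k = ⊥

/-- Lower central series of the subalgebra `p` of `(E, μ)`. -/
def lcsOn (μ : E →ₗ[ℝ] E →ₗ[ℝ] E) (p : Submodule ℝ E) : ℕ → Submodule ℝ E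
  | 0 => p
  | k + 1 => bracketSpan μ p (lcsOn μ p k)

/-- The subalgebra `p` of `(E, μ)` is a nilpotent Lie algebra. -/
def IsNilpotentOn (μ : E →ₗ[ℝ] E →ₗ[ℝ] E) (p : Submodule ℝ E) : Prop := ∃ k, lcsOn μ p k = ⊥

/-- `p` is an ideal of `(E, μ)`. -/
def IsIdeal (μ : E →ₗ[ℝ] E →ₗ[ℝ] E) (p : Submodule ℝ E) : Prop := ∀ X : E, ∀ Y ∈ p, μ X Y ∈ p

/-- `p` is the nilradical (maximal nilpotent ideal) of `(E, μ)`. -/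
def IsNilradical (μ : E →ₗ[ℝ] E →ₗ[ℝ] E) (p : Submodule ℝ E) : Prop :=
  IsIdeal μ p ∧ IsNilpotentOn μ p ∧ ∀ q, IsIdeal μ q → IsNilpotentOn μ q → q ≤ p

/-- The natural action `π(f)μ` of `f ∈ End(E)` on bilinear maps:
`(π(f)μ)(X,Y) = f(μ(X,Y)) - μ(fX,Y) - μ(X,fY)`. -/
def piAct (f : E →ₗ[ℝ] E) (μ : E →ₗ[ℝ] E →ₗ[ℝ] E) : E →ₗ[ℝ] E →ₗ[ℝ] E :=
  (LinearMap.llcomp ℝ E E E f) ∘ₗ μ - μ ∘ₗ f - (LinearMap.lcomp ℝ E f) ∘ₗ μ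

/-- The center of `(E, μ)`. -/
def centerB (μ : E →ₗ[ℝ] E →ₗ[ℝ] E) : Submodule ℝ E where
  carrier := {X | μ X = 0}
  add_mem' := by intro a b ha hb; simp only [Set.mem_setOf_eq, map_add] at *; rw [ha, hb, add_zero]
  zero_mem' := by simp only [Set.mem_setOf_eq, map_zero]
  smul_mem' := by intro c a ha; simp only [Set.mem_setOf_eq, map_smul] at *; rw [ha, smul_zero]

end Alg

/-! ### Metric notions -/

section MetricDefs

variable {E : Type*} [NormedAddCommGroup E] [InnerProductSpace ℝ E] [FiniteDimensional ℝ E]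

/-- The transpose of an operator with respect to the inner product. -/
def transp (f : E →ₗ[ℝ] E) : E →ₗ[ℝ] E := LinearMap.adjoint f

/-- The symmetric part `S(f) = (f + fᵗ)/2` of an operator. -/
def symPart (f : E →ₗ[ℝ] E) : E →ₗ[ℝ] E := (1 / 2 : ℝ) • (f + transp f)

variable (E) in
/-- A fixed orthonormal basis of `E`. -/
def stdONB : OrthonormalBasis (Fin (Module.finrank ℝ E)) ℝ E := stdOrthonormalBasis ℝ E

/-- The operator `R` appearing in the formula for the Ricci operator of a metric Lie algebra:
`⟨R X, X⟩ = -(1/2) Σ ⟨[X,Xᵢ],Xⱼ⟩² + (1/4) Σ ⟨[Xᵢ,Xⱼ],X⟩²` for any orthonormal basis `{Xᵢ}`. -/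
def Rop (μ : E →ₗ[ℝ] E →ₗ[ℝ] E) : E →ₗ[ℝ] E :=
  (-(1 / 2 : ℝ)) • ∑ i, (transp (μ (stdONB E i))) ∘ₗ (μ (stdONB E i))
    + (1 / 4 : ℝ) • ∑ i, (μ (stdONB E i)) ∘ₗ (transp (μ (stdONB E i)))

/-- The symmetric operator `B` defined by the Killing form: `⟨B X, X⟩ = tr((ad X)²)`. -/
def Bop (μ : E →ₗ[ℝ] E →ₗ[ℝ] E) : E →ₗ[ℝ] E :=
  ∑ i, (((LinearMap.trace ℝ E) ∘ₗ (LinearMap.lcomp ℝ E (μ (stdONB E i))) ∘ₗ μ).smulRight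
    (stdONB E i))

/-- The mean curvature vector `H`, characterized by `⟨H, X⟩ = tr (ad X)`. -/
def meanCurv (μ : E →ₗ[ℝ] E →ₗ[ℝ] E) : E :=
  ∑ i, (LinearMap.trace ℝ E (μ (stdONB E i))) • (stdONB E i : E)

/-- The Ricci operator `Ric = R - (1/2) B - S(ad H)` of a metric Lie algebra. -/
def Ric (μ : E →ₗ[ℝ] E →ₗ[ℝ] E) : E →ₗ[ℝ] E :=
  Rop μ - (1 / 2 : ℝ) • Bop μ - symPart (μ (meanCurv μ))

/-- `(E, μ, ⟨⬝,⬝⟩)` is a solsoliton: `Ric = c I + D` for some `c ∈ ℝ` and derivation `D`. -/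
def IsSolsoliton (μ : E →ₗ[ℝ] E →ₗ[ℝ] E) : Prop :=
  ∃ (c : ℝ) (D : E →ₗ[ℝ] E), IsDeriv μ D ∧ Ric μ = c • LinearMap.id + D

/-- The natural inner product on bilinear maps, `⟨μ,ν⟩ = Σ ⟨μ(Xᵢ,Xⱼ), ν(Xᵢ,Xⱼ)⟩`. -/
def binner (μ ν : E →ₗ[ℝ] E →ₗ[ℝ] E) : ℝ :=
  ∑ i, ∑ j, ⟪μ (stdONB E i) (stdONB E j), ν (stdONB E i) (stdONB E j)⟫

/-- Orthogonal projection onto a subspace, as an endomorphism of `E`. -/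
def projL (p : Submodule ℝ E) : E →ₗ[ℝ] E :=
  p.subtype ∘ₗ (Submodule.orthogonalProjectionOnto p).toLinearMap

/-- An orthonormal basis of the subspace `p`, as a family of vectors of `E`. -/
def onbOf (p : Submodule ℝ E) : Fin (Module.finrank ℝ ↥p) → E :=
  fun i => ((stdOrthonormalBasis ℝ ↥p) i : E)

/-- The restriction `ad X |_p` of `ad X` to the subspace `p`, as an endomorphism of `E`
(it kills `pᗮ`). -/
def adOn (μ : E →ₗ[ℝ] E →ₗ[ℝ] E) (p : Submodule ℝ E) (X : E) : E →ₗ[ℝ] E :=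
  (μ X) ∘ₗ projL p

/-- The Ricci operator of the restricted metric Lie algebra `(p, μ|ₚ, ⟨⬝,⬝⟩|ₚ)`, for `p` a
bracket-closed subspace, realized as an endomorphism of `E` killing `pᗮ`.  (For `p` nilpotent
this is the full Ricci operator of `p`.) -/
def RopOn (μ : E →ₗ[ℝ] E →ₗ[ℝ] E) (p : Submodule ℝ E) : E →ₗ[ℝ] E :=
  (-(1 / 2 : ℝ)) • ∑ i, (transp (adOn μ p (onbOf p i))) ∘ₗ (adOn μ p (onbOf p i))
    + (1 / 4 : ℝ) • ∑ i, (adOn μ p (onbOf p i)) ∘ₗ (transp (adOn μ p (onbOf p i)))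

/-- The metric nilpotent Lie algebra `(p, μ|ₚ, ⟨⬝,⬝⟩|ₚ)` is a nilsoliton with Ricci operator
`c I + D₁`, where `D₁` is (induced by) a derivation of `p`. -/
def IsNilsolitonOn (μ : E →ₗ[ℝ] E →ₗ[ℝ] E) (p : Submodule ℝ E) (c : ℝ) (D₁ : E →ₗ[ℝ] E) :
    Prop :=
  (∀ X ∈ p, D₁ X ∈ p) ∧ (∀ X ∈ p, ∀ Y ∈ p, D₁ (μ X Y) = μ (D₁ X) Y + μ X (D₁ Y)) ∧
    ∀ X ∈ p, RopOn μ p X = c • X + D₁ X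

end MetricDefs

theorem piAct_apply {E : Type*} [AddCommGroup E] [Module ℝ E]
    (f : E →ₗ[ℝ] E) (μ : E →ₗ[ℝ] E →ₗ[ℝ] E) (X Y : E) :
    piAct f μ X Y = f (μ X Y) - μ (f X) Y - μ X (f Y) := rfl

theorem IsLieBracket.skew {E : Type*} [AddCommGroup E] [Module ℝ E]
    {μ : E →ₗ[ℝ] E →ₗ[ℝ] E} (h : IsLieBracket μ) (X Y : E) : μ X Y = -μ Y X := by
  have hXY := h.1 (X + Y)
  simp only [map_add, LinearMap.add_apply, h.1, zero_add, add_zero] at hXY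
  exact eq_neg_of_add_eq_zero_right hXY

section Trace

variable {E : Type*} [NormedAddCommGroup E] [InnerProductSpace ℝ E] [FiniteDimensional ℝ E]

theorem trace_transp_comp_comp (A f : E →ₗ[ℝ] E) :
    LinearMap.trace ℝ E ((transp A ∘ₗ A) ∘ₗ f) =
      ∑ j, ⟪A (f (stdONB E j)), A (stdONB E j)⟫ := by
  rw [LinearMap.trace_eq_sum_inner _ (stdONB E)]
  refine Finset.sum_congr rfl fun j _ => ?_
  simp only [LinearMap.comp_apply, transp, LinearMap.adjoint_inner_right]
  exact real_inner_comm _ _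

theorem trace_comp_transp_comp (A f : E →ₗ[ℝ] E) :
    LinearMap.trace ℝ E ((A ∘ₗ transp A) ∘ₗ f) =
      ∑ j, ⟪f (A (stdONB E j)), A (stdONB E j)⟫ := by
  rw [LinearMap.comp_assoc, LinearMap.trace_comp_comm',
    LinearMap.trace_eq_sum_inner _ (stdONB E)]
  refine Finset.sum_congr rfl fun j _ => ?_
  simp only [LinearMap.comp_apply, transp, LinearMap.adjoint_inner_right]
  exact real_inner_comm _ _

theorem trace_Rop_comp (μ : E →ₗ[ℝ] E →ₗ[ℝ] E) (f : E →ₗ[ℝ] E) :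
    LinearMap.trace ℝ E (Rop μ ∘ₗ f) =
      -(1 / 2) * (∑ i, ∑ j, ⟪μ (stdONB E i) (f (stdONB E j)), μ (stdONB E i) (stdONB E j)⟫) +
        (1 / 4) * ∑ i, ∑ j, ⟪f (μ (stdONB E i) (stdONB E j)), μ (stdONB E i) (stdONB E j)⟫ := by
  have sum_comp (g : Fin (Module.finrank ℝ E) → Module.End ℝ E) :
      (∑ i, g i) ∘ₗ f = ∑ i, g i ∘ₗ f := Finset.sum_mul Finset.univ g f
  simp only [Rop, LinearMap.add_comp, LinearMap.smul_comp, sum_comp, map_add, map_smul,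
    map_sum, trace_transp_comp_comp, trace_comp_transp_comp, smul_eq_mul]

theorem sum_inner_left_eq_sum_inner_right {μ : E →ₗ[ℝ] E →ₗ[ℝ] E} (h : IsLieBracket μ)
    (f : E →ₗ[ℝ] E) :
    ∑ i, ∑ j, ⟪μ (f (stdONB E i)) (stdONB E j), μ (stdONB E i) (stdONB E j)⟫ =
      ∑ i, ∑ j, ⟪μ (stdONB E i) (f (stdONB E j)), μ (stdONB E i) (stdONB E j)⟫ := by
  rw [Finset.sum_comm]
  refine Finset.sum_congr rfl fun i _ => Finset.sum_congr rfl fun j _ => ?_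
  rw [h.skew (f _), h.skew (stdONB E j), inner_neg_neg]

theorem trace_Rop_comp_eq_binner {μ : E →ₗ[ℝ] E →ₗ[ℝ] E} (h : IsLieBracket μ) (f : E →ₗ[ℝ] E) :
    LinearMap.trace ℝ E (Rop μ ∘ₗ f) = (1 / 4) * binner (piAct f μ) μ := by
  simp only [trace_Rop_comp, binner, piAct_apply, inner_sub_left, Finset.sum_sub_distrib,
    sum_inner_left_eq_sum_inner_right h]
  ring

theorem binner_piAct_id (μ : E →ₗ[ℝ] E →ₗ[ℝ] E) :
    binner (piAct LinearMap.id μ) μ = -binner μ μ := by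
  simp [binner, piAct_apply]

end Trace

/-- for a metric solvable Lie algebra, `tr (R ∘ f) = (1/4) ⟨π(f)[⬝,⬝], [⬝,⬝]⟩` for
every endomorphism `f`; in particular (taking `f = I`) the scalar curvature is
`tr R = -(1/4) ‖[⬝,⬝]‖²`. -/
theorem trace_R_eq_moment_map
    {E : Type*} [NormedAddCommGroup E] [InnerProductSpace ℝ E] [FiniteDimensional ℝ E]
    (μ : E →ₗ[ℝ] E →ₗ[ℝ] E) (hLie : IsLieBracket μ) (hsolv : IsSolvableB μ) :
    (∀ f : E →ₗ[ℝ] E,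
        LinearMap.trace ℝ E (Rop μ ∘ₗ f) = (1 / 4) * binner (piAct f μ) μ) ∧
      LinearMap.trace ℝ E (Rop μ) = -(1 / 4) * binner μ μ := by
  refine ⟨trace_Rop_comp_eq_binner hLie, ?_⟩
  have h := trace_Rop_comp_eq_binner hLie LinearMap.id
  rw [LinearMap.comp_id, binner_piAct_id] at h
  rw [h]
  ring
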